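/- Let ξ ∈ ℝ with −α < ξ < 0, and let u ∈ C²([0,R)) be the solution of the Cauchy problem M⁺(u'') + g(u) = 0, u(0) = ξ, u'(0) = 0 on its maximal interval of existence [0,R). Then R = +∞, u is oscillating (it has an unbounded sequence of zeros), u is periodic (there exists T > 0 with u(r+T) = u(r) for all r ≥ 0), and sup_{r ≥ 0} |u(r)| = −ξ. -/

import Mathlib

open Set Filter Topology

/-- Truncation of a real number to the interval `[-m, m]`. -/
def clampAbs (m s : ℝ) : ℝ := max (-m) (min m s)

section clampAbs

variable {m s : ℝ}

lemma lipschitzWith_clampAbs (m : ℝ) : LipschitzWith 1 (clampAbs m) :=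
  (LipschitzWith.id.const_min m).const_max (-m)

lemma clampAbs_mem (hm : 0 ≤ m) (s : ℝ) : clampAbs m s ∈ Icc (-m) m :=
  ⟨le_max_left _ _, max_le (by linarith) (min_le_left _ _)⟩

lemma clampAbs_of_abs_le (h : |s| ≤ m) : clampAbs m s = s := by
  have := abs_le.1 h
  simp [clampAbs, this.1, this.2]

lemma clampAbs_neg (hm : 0 ≤ m) (s : ℝ) : clampAbs m (-s) = -clampAbs m s := by
  unfold clampAbs
  grind

lemma clampAbs_pos (hm : 0 < m) (hs : 0 < s) : 0 < clampAbs m s :=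
  lt_max_of_lt_right (lt_min hm hs)

end clampAbs

/-- The pair `(x, y)` of functions solves the first order system `x' = y`, `y' = F x` on `S`. -/
def SolvesNewton (F x y : ℝ → ℝ) (S : Set ℝ) : Prop :=
  ∀ t ∈ S, HasDerivWithinAt x (y t) S t ∧ HasDerivWithinAt y (F (x t)) S t

namespace SolvesNewton

variable {F x y x₁ y₁ x₂ y₂ : ℝ → ℝ} {S S' : Set ℝ} {a b : ℝ}

lemma mono (h : SolvesNewton F x y S) (hS : S' ⊆ S) : SolvesNewton F x y S' :=
  fun t ht => ⟨(h t (hS ht)).1.mono hS, (h t (hS ht)).2.mono hS⟩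

lemma congr_force {F' : ℝ → ℝ} (h : SolvesNewton F x y S) (hF : ∀ t ∈ S, F (x t) = F' (x t)) :
    SolvesNewton F' x y S :=
  fun t ht => ⟨(h t ht).1, hF t ht ▸ (h t ht).2⟩

lemma continuousOn_fst (h : SolvesNewton F x y S) : ContinuousOn x S :=
  fun t ht => (h t ht).1.continuousWithinAt

lemma continuousOn_snd (h : SolvesNewton F x y S) : ContinuousOn y S :=
  fun t ht => (h t ht).2.continuousWithinAt

lemma hasDerivWithinAt_Ici (h : SolvesNewton F x y (Icc a b)) {t : ℝ} (ht : t ∈ Ico a b) :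
    HasDerivWithinAt x (y t) (Ici t) t ∧ HasDerivWithinAt y (F (x t)) (Ici t) t := by
  have hmem : Icc a b ∈ 𝓝[Ici t] t := by
    filter_upwards [Icc_mem_nhdsGE ht.2] with s hs using ⟨ht.1.trans hs.1, hs.2⟩
  have h' := h t (Ico_subset_Icc_self ht)
  exact ⟨h'.1.mono_of_mem_nhdsWithin hmem, h'.2.mono_of_mem_nhdsWithin hmem⟩

lemma comp_add_const (h : SolvesNewton F x y S) (c : ℝ) (hS : MapsTo (· + c) S' S) :
    SolvesNewton F (fun t => x (t + c)) (fun t => y (t + c)) S' := by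
  intro t ht
  have hd : HasDerivWithinAt (fun s : ℝ => s + c) 1 S' t := (hasDerivWithinAt_id t S').add_const c
  have h' := h (t + c) (hS ht)
  refine ⟨?_, ?_⟩
  · simpa [Function.comp_def] using h'.1.comp t hd hS
  · simpa [Function.comp_def] using h'.2.comp t hd hS

lemma comp_const_sub (h : SolvesNewton F x y S) (c : ℝ) (hS : MapsTo (c - ·) S' S) :
    SolvesNewton F (fun t => x (c - t)) (fun t => -y (c - t)) S' := by
  intro t ht
  have hd : HasDerivWithinAt (fun s : ℝ => c - s) (-1) S' t :=
    (hasDerivWithinAt_id t S').const_sub c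
  have h' := h (c - t) (hS ht)
  refine ⟨?_, ?_⟩
  · simpa [Function.comp_def] using h'.1.comp t hd hS
  · simpa [Function.comp_def, Pi.neg_def] using (h'.2.comp t hd hS).neg

lemma lipschitzOnWith_field {K : NNReal} {s : Set ℝ} (hF : LipschitzOnWith K F s) :
    LipschitzOnWith (max 1 K) (fun p : ℝ × ℝ => (p.2, F p.1)) (s ×ˢ univ) := by
  have h1 : LipschitzOnWith 1 (fun p : ℝ × ℝ => p.2) (s ×ˢ univ) :=
    LipschitzWith.prod_snd.lipschitzOnWith
  have h2 : LipschitzOnWith (K * 1) (fun p : ℝ × ℝ => F p.1) (s ×ˢ univ) :=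
    hF.comp LipschitzWith.prod_fst.lipschitzOnWith (fun p hp => hp.1)
  simpa using h1.prodMk h2

lemma eqOn {K : NNReal} {s : Set ℝ} (hF : LipschitzOnWith K F s)
    (h₁ : SolvesNewton F x₁ y₁ (Icc a b)) (h₂ : SolvesNewton F x₂ y₂ (Icc a b))
    (hs₁ : ∀ t ∈ Icc a b, x₁ t ∈ s) (hs₂ : ∀ t ∈ Icc a b, x₂ t ∈ s)
    (hx : x₁ a = x₂ a) (hy : y₁ a = y₂ a) :
    ∀ t ∈ Icc a b, x₁ t = x₂ t ∧ y₁ t = y₂ t := by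
  have := ODE_solution_unique_of_mem_Icc_right (v := fun _ (p : ℝ × ℝ) => (p.2, F p.1))
    (s := fun _ => s ×ˢ univ) (K := max 1 K) (a := a) (b := b)
    (f := fun t => (x₁ t, y₁ t)) (g := fun t => (x₂ t, y₂ t))
    (fun t _ => lipschitzOnWith_field hF)
    (h₁.continuousOn_fst.prodMk h₁.continuousOn_snd)
    (fun t ht => (h₁.hasDerivWithinAt_Ici ht).1.prodMk (h₁.hasDerivWithinAt_Ici ht).2)
    (fun t ht => ⟨hs₁ t (Ico_subset_Icc_self ht), mem_univ _⟩)
    (h₂.continuousOn_fst.prodMk h₂.continuousOn_snd)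
    (fun t ht => (h₂.hasDerivWithinAt_Ici ht).1.prodMk (h₂.hasDerivWithinAt_Ici ht).2)
    (fun t ht => ⟨hs₂ t (Ico_subset_Icc_self ht), mem_univ _⟩) (by simp [hx, hy])
  intro t ht
  simpa using this ht

/-- A bounded Lipschitz force has solutions on arbitrarily long time intervals. -/
lemma exists_Icc {K : NNReal} (hF : LipschitzWith K F) {B : ℝ} (hB : ∀ s, |F s| ≤ B)
    {T : ℝ} (hT : 0 < T) (ξ : ℝ) :
    ∃ x y : ℝ → ℝ, SolvesNewton F x y (Icc (-T) T) ∧ x 0 = ξ ∧ y 0 = 0 := by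
  have hB0 : 0 ≤ B := (abs_nonneg _).trans (hB 0)
  set M := B * T with hM
  have hM0 : 0 ≤ M := by positivity
  have hfield : LipschitzWith (max 1 K) (fun p : ℝ × ℝ => (clampAbs M p.2, F p.1)) := by
    simpa using ((lipschitzWith_clampAbs M).comp LipschitzWith.prod_snd).prodMk
      (hF.comp LipschitzWith.prod_fst)
  set L : NNReal := ⟨max M B, le_max_of_le_left hM0⟩ with hL
  have h0 : (0 : ℝ) ∈ Icc (-T) T := ⟨by linarith, hT.le⟩
  have hLT : ((L * ⟨T, hT.le⟩ : NNReal) : ℝ) = L * T := rfl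
  have hPL : IsPicardLindelof (fun (_ : ℝ) (p : ℝ × ℝ) => (clampAbs M p.2, F p.1))
      (tmin := -T) (tmax := T)
      ⟨0, h0⟩ (ξ, 0) (L * ⟨T, hT.le⟩) 0 L (max 1 K) :=
    { lipschitzOnWith := fun _ _ => hfield.lipschitzOnWith
      continuousOn := fun _ _ => continuousOn_const
      norm_le := fun t _ p _ => by
        simp only [Prod.norm_def, Real.norm_eq_abs]
        exact max_le_max (_root_.abs_le.2 (clampAbs_mem hM0 _)) (hB _)
      mul_max_le := by simp [hLT] }
  obtain ⟨γ, hγ0, hγ⟩ := hPL.exists_eq_forall_mem_Icc_hasDerivWithinAt₀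
  have hx : ∀ t ∈ Icc (-T) T,
      HasDerivWithinAt (fun s => (γ s).1) (clampAbs M (γ t).2) (Icc (-T) T) t :=
    fun t ht => (hγ t ht).fst
  have hy : ∀ t ∈ Icc (-T) T, HasDerivWithinAt (fun s => (γ s).2) (F (γ t).1) (Icc (-T) T) t :=
    fun t ht => (hγ t ht).snd
  have hγ0' : γ 0 = (ξ, 0) := hγ0
  have hbound : ∀ t ∈ Icc (-T) T, |(γ t).2| ≤ M := by
    intro t ht
    have := (convex_Icc (-T) T).norm_image_sub_le_of_norm_hasDerivWithin_le (C := B) hy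
      (fun s _ => hB _) h0 ht
    simp only [hγ0', sub_zero, Real.norm_eq_abs] at this
    exact this.trans (mul_le_mul_of_nonneg_left (abs_le.2 ht) hB0)
  refine ⟨fun s => (γ s).1, fun s => (γ s).2, fun t ht => ⟨?_, hy t ht⟩, by simp [hγ0'],
    by simp [hγ0']⟩
  simpa only [clampAbs_of_abs_le (hbound t ht)] using hx t ht

/-- If the force points towards the origin and pushes to the left at `s` at least as much as it
pushes to the right at `-s`, then a motion starting at rest from `ξ ≤ 0` is confined to
`[ξ, -ξ]`. -/
lemma abs_le (hFc : Continuous F) (hneg : ∀ s < 0, 0 < F s) (hpos : ∀ s > 0, F s < 0)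
    (hsum : ∀ s ≥ 0, F s + F (-s) ≤ 0) {ξ : ℝ} (hξ : ξ ≤ 0)
    (h : SolvesNewton F x y (Icc 0 b)) (hx : x 0 = ξ) (hy : y 0 = 0) :
    ∀ t ∈ Icc 0 b, |x t| ≤ -ξ := by
  set V : ℝ → ℝ := fun s => -∫ r in (0 : ℝ)..s, F r with hV
  have hV' : ∀ s, HasDerivAt V (-F s) s := fun s =>
    (intervalIntegral.integral_hasDerivAt_right (hFc.intervalIntegrable _ _)
      hFc.aestronglyMeasurable.stronglyMeasurableAtFilter hFc.continuousAt).neg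
  have hVc : Continuous V := continuous_iff_continuousAt.2 fun s => (hV' s).continuousAt
  have hVpos : StrictMonoOn V (Ici 0) := by
    refine strictMonoOn_of_deriv_pos (convex_Ici 0) hVc.continuousOn fun s hs => ?_
    rw [interior_Ici] at hs
    rw [(hV' s).deriv]
    linarith [hpos s hs]
  have hVneg : StrictAntiOn V (Iic 0) := by
    refine strictAntiOn_of_deriv_neg (convex_Iic 0) hVc.continuousOn fun s hs => ?_
    rw [interior_Iic] at hs
    rw [(hV' s).deriv]
    linarith [hneg s hs]
  have hVcmp : V ξ ≤ V (-ξ) := by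
    have hD : ∀ s, HasDerivAt (fun s => V s - V (-s)) (-F s - F (-s)) s := fun s => by
      have := (hV' s).sub ((hV' (-s)).comp s (hasDerivAt_neg s))
      convert! this using 1
      ring
    have hm : MonotoneOn (fun s => V s - V (-s)) (Ici 0) := by
      refine monotoneOn_of_deriv_nonneg (convex_Ici 0)
        (fun s _ => (hD s).continuousAt.continuousWithinAt)
        (fun s _ => (hD s).differentiableAt.differentiableWithinAt) fun s hs => ?_
      rw [interior_Ici] at hs
      rw [(hD s).deriv]
      linarith [hsum s (le_of_lt hs)]
    have := hm (self_mem_Ici) (show -ξ ∈ Ici 0 by simpa using hξ) (by linarith)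
    simp at this
    linarith
  have hE : ∀ t ∈ Icc 0 b, y t ^ 2 / 2 + V (x t) = y 0 ^ 2 / 2 + V (x 0) := by
    refine constant_of_has_deriv_right_zero ?_ fun t ht => ?_
    · exact ((h.continuousOn_snd.pow 2).div_const 2).add
        (hVc.comp_continuousOn h.continuousOn_fst)
    · obtain ⟨h1, h2⟩ := h.hasDerivWithinAt_Ici ht
      have := ((h2.pow 2).div_const 2).add ((hV' (x t)).comp_hasDerivWithinAt t h1)
      convert! this using 1
      simp
      ring
  intro t ht
  have hEt := hE t ht
  rw [hx, hy] at hEt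
  have hle : V (x t) ≤ V ξ := by nlinarith [sq_nonneg (y t)]
  refine _root_.abs_le.2 ⟨?_, ?_⟩
  · by_contra! hlt
    have := hVneg (show x t ∈ Iic 0 by simp; linarith) (show ξ ∈ Iic 0 from hξ) (by linarith)
    linarith
  · by_contra! hlt
    have := hVpos (show -ξ ∈ Ici 0 by simpa using hξ) (show x t ∈ Ici 0 by simp; linarith) hlt
    linarith

lemma hasDerivAt_of_Ici (h : SolvesNewton F x y (Ici 0)) {t : ℝ} (ht : 0 < t) :
    HasDerivAt x (y t) t ∧ HasDerivAt y (F (x t)) t :=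
  ⟨(h t ht.le).1.hasDerivAt (Ici_mem_nhds ht), (h t ht.le).2.hasDerivAt (Ici_mem_nhds ht)⟩

lemma exists_nonneg (hneg : ∀ s < 0, 0 < F s) (h : SolvesNewton F x y (Ici 0)) (hy : y 0 = 0) :
    ∃ t ≥ 0, 0 ≤ x t := by
  by_contra! hx
  have hmono : StrictMonoOn y (Ici 0) := by
    refine strictMonoOn_of_deriv_pos (convex_Ici 0) h.continuousOn_snd fun t ht => ?_
    rw [interior_Ici] at ht
    rw [(h.hasDerivAt_of_Ici ht).2.deriv]
    exact hneg _ (hx t (le_of_lt ht))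
  have h1 : 0 < y 1 := hy ▸ hmono self_mem_Ici (show (1 : ℝ) ∈ Ici 0 by simp) one_pos
  have hsub : Ici (1 : ℝ) ⊆ Ici 0 := Ici_subset_Ici.2 zero_le_one
  have hT : (1 : ℝ) ≤ 1 + -x 1 / y 1 := by
    have : 0 ≤ -x 1 / y 1 := div_nonneg (by linarith [hx 1 zero_le_one]) h1.le
    linarith
  have := (convex_Ici (1 : ℝ)).mul_sub_le_image_sub_of_le_deriv (C := y 1)
    (h.continuousOn_fst.mono hsub)
    (fun t ht => by
      rw [interior_Ici] at ht
      exact (h.hasDerivAt_of_Ici (one_pos.trans ht)).1.differentiableAt.differentiableWithinAt)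
    (fun t ht => by
      rw [interior_Ici] at ht
      rw [(h.hasDerivAt_of_Ici (one_pos.trans ht)).1.deriv]
      exact (hmono (hsub self_mem_Ici) (hsub (Ioi_subset_Ici_self ht)) ht).le)
    1 self_mem_Ici (1 + -x 1 / y 1) hT hT
  rw [add_sub_cancel_left, mul_div_cancel₀ _ h1.ne'] at this
  linarith [hx _ (zero_le_one.trans hT)]

lemma exists_fst_eq_zero (hneg : ∀ s < 0, 0 < F s) (h : SolvesNewton F x y (Ici 0))
    (hx : x 0 ≤ 0) (hy : y 0 = 0) : ∃ t ≥ 0, x t = 0 := by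
  obtain ⟨t, ht, hxt⟩ := h.exists_nonneg hneg hy
  obtain ⟨s, hs, hxs⟩ := intermediate_value_Icc ht
    (h.continuousOn_fst.mono Icc_subset_Ici_self) ⟨hx, hxt⟩
  exact ⟨s, hs.1, hxs⟩

lemma exists_snd_eq_zero (hFc : Continuous F) (hneg : ∀ s < 0, 0 < F s)
    (hpos : ∀ s > 0, F s < 0) (h : SolvesNewton F x y (Ici 0))
    {ξ : ℝ} (hξ : ξ < 0) (hx : x 0 = ξ) (hy : y 0 = 0) (hb : ∀ t ≥ 0, |x t| ≤ -ξ) :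
    ∃ t > 0, y t = 0 := by
  by_contra! hne
  have hypos : ∀ t > 0, 0 < y t := by
    by_contra! hcon
    obtain ⟨a, ha, hya⟩ := hcon
    have hyneg : ∀ t > 0, y t < 0 := by
      by_contra! hcon
      obtain ⟨b, hb, hyb⟩ := hcon
      obtain ⟨c, hc, hyc⟩ := isPreconnected_Ioi.intermediate_value (s := Ioi (0 : ℝ)) ha hb
        (h.continuousOn_snd.mono Ioi_subset_Ici_self) ⟨hya, hyb⟩
      exact hne c hc hyc
    have hanti : StrictAntiOn x (Ici 0) := by
      refine strictAntiOn_of_deriv_neg (convex_Ici 0) h.continuousOn_fst fun t ht => ?_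
      rw [interior_Ici] at ht
      rw [(h.hasDerivAt_of_Ici ht).1.deriv]
      exact hyneg t ht
    have h1 := hanti self_mem_Ici (show (1 : ℝ) ∈ Ici 0 by simp) one_pos
    have h2 := (_root_.abs_le.1 (hb 1 zero_le_one)).1
    linarith
  have hmono : StrictMonoOn x (Ici 0) := by
    refine strictMonoOn_of_deriv_pos (convex_Ici 0) h.continuousOn_fst fun t ht => ?_
    rw [interior_Ici] at ht
    rw [(h.hasDerivAt_of_Ici ht).1.deriv]
    exact hypos t ht
  obtain ⟨t₀, ht₀, hx₀⟩ := h.exists_fst_eq_zero hneg (hx ▸ hξ.le) hy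
  obtain ⟨a, ha, hxa⟩ : ∃ a > 0, 0 < x a :=
    ⟨t₀ + 1, by linarith, hx₀ ▸ hmono ht₀ (show t₀ + 1 ∈ Ici 0 by simp; linarith) (by linarith)⟩
  have hxa' : x a ≤ -ξ := (_root_.abs_le.1 (hb a ha.le)).2
  obtain ⟨m, hm, hmax⟩ := isCompact_Icc.exists_isMaxOn (nonempty_Icc.2 hxa') hFc.continuousOn
  have hFm : F m < 0 := hpos m (hxa.trans_le hm.1)
  have hsub : Ici a ⊆ Ici 0 := Ici_subset_Ici.2 ha.le
  have hT : a ≤ a + y a / -F m := by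
    have : 0 ≤ y a / -F m := div_nonneg (hypos a ha).le (by linarith)
    linarith
  have := (convex_Ici a).image_sub_le_mul_sub_of_deriv_le (C := F m)
    (h.continuousOn_snd.mono hsub)
    (fun t ht => by
      rw [interior_Ici] at ht
      exact (h.hasDerivAt_of_Ici (ha.trans ht)).2.differentiableAt.differentiableWithinAt)
    (fun t ht => by
      rw [interior_Ici] at ht
      rw [(h.hasDerivAt_of_Ici (ha.trans ht)).2.deriv]
      exact hmax ⟨(hmono ha.le (hsub (Ioi_subset_Ici_self ht)) ht).le,
        (_root_.abs_le.1 (hb t (hsub (Ioi_subset_Ici_self ht)))).2⟩)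
    a self_mem_Ici (a + y a / -F m) hT hT
  rw [add_sub_cancel_left, div_neg, mul_neg, mul_div_cancel₀ _ hFm.ne] at this
  linarith [hypos _ (ha.trans_le hT)]

/-- A motion at rest at times `0` and `t₀` is periodic with period `2 * t₀`. -/
lemma add_two_mul_eq {K : NNReal} (hF : LipschitzWith K F) (h : SolvesNewton F x y (Ici 0))
    (hy : y 0 = 0) {t₀ : ℝ} (ht₀ : 0 ≤ t₀) (hyt : y t₀ = 0) :
    ∀ t ≥ 0, x (t + 2 * t₀) = x t := by
  have hF' := hF.lipschitzOnWith (s := univ)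
  have hend : x (2 * t₀) = x 0 ∧ y (2 * t₀) = 0 := by
    have hrev : SolvesNewton F (fun t => x (2 * t₀ - t)) (fun t => -y (2 * t₀ - t))
        (Icc t₀ (2 * t₀)) :=
      h.comp_const_sub (2 * t₀) fun t ht => by simpa using ht.2
    have := eqOn hF' (h.mono (Icc_subset_Ici_self.trans (Ici_subset_Ici.2 ht₀))) hrev
      (fun _ _ => mem_univ _) (fun _ _ => mem_univ _)
      (by congr 1; ring) (by rw [show 2 * t₀ - t₀ = t₀ by ring, hyt, neg_zero])
      (2 * t₀) ⟨by linarith, le_rfl⟩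
    simpa [hy] using this
  intro t ht
  have hshift : SolvesNewton F (fun t => x (t + 2 * t₀)) (fun t => y (t + 2 * t₀)) (Icc 0 t) :=
    h.comp_add_const (2 * t₀) fun s hs => show 0 ≤ s + 2 * t₀ by linarith [hs.1]
  exact (eqOn hF' hshift (h.mono Icc_subset_Ici_self)
    (fun _ _ => mem_univ _) (fun _ _ => mem_univ _)
    (by simp [hend.1]) (by simp [hend.2, hy]) t ⟨ht, le_rfl⟩).1

end SolvesNewton

/-- The value of `u''` solving `M⁺(u'') + z = 0`. -/
noncomputable def pucciAcceleration (lam Lam z : ℝ) : ℝ := min (-z / Lam) (-z / lam)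

section Pucci

variable {lam Lam : ℝ}

lemma pucci_add_eq_zero_iff (hlam : 0 < lam) (hlamLam : lam ≤ Lam) (d z : ℝ) :
    (if 0 ≤ d then Lam * d else lam * d) + z = 0 ↔ d = pucciAcceleration lam Lam z := by
  have hLam : 0 < Lam := hlam.trans_le hlamLam
  unfold pucciAcceleration
  rcases le_or_gt z 0 with hz | hz
  · have hle : -z / Lam ≤ -z / lam := div_le_div_of_nonneg_left (by linarith) hlam hlamLam
    rw [min_eq_left hle, eq_div_iff hLam.ne']
    split_ifs with hd
    · constructor <;> intro h <;> linarith
    · constructor <;> intro h <;> nlinarith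
  · have hle : -z / lam ≤ -z / Lam := by
      rw [neg_div, neg_div]
      exact neg_le_neg (div_le_div_of_nonneg_left hz.le hlam hlamLam)
    rw [min_eq_right hle, eq_div_iff hlam.ne']
    split_ifs with hd
    · constructor <;> intro h <;> nlinarith
    · constructor <;> intro h <;> linarith

lemma locallyLipschitz_pucciAcceleration (lam Lam : ℝ) :
    LocallyLipschitz (pucciAcceleration lam Lam) := by
  have h : ∀ c : ℝ, LocallyLipschitz fun z : ℝ => -z / c := fun c =>
    ContDiff.locallyLipschitz (𝕂 := ℝ) (by fun_prop)
  exact (h Lam).min (h lam)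

lemma pucciAcceleration_pos (hlam : 0 < lam) (hLam : 0 < Lam) {z : ℝ} (hz : z < 0) :
    0 < pucciAcceleration lam Lam z :=
  lt_min (div_pos (by linarith) hLam) (div_pos (by linarith) hlam)

lemma pucciAcceleration_neg (hlam : 0 < lam) {z : ℝ} (hz : 0 < z) :
    pucciAcceleration lam Lam z < 0 :=
  (min_le_right _ _).trans_lt (div_neg_of_neg_of_pos (by linarith) hlam)

lemma pucciAcceleration_add_neg_le (lam Lam z : ℝ) :
    pucciAcceleration lam Lam z + pucciAcceleration lam Lam (-z) ≤ 0 := by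
  have h1 : pucciAcceleration lam Lam z ≤ -z / Lam := min_le_left _ _
  have h2 : pucciAcceleration lam Lam (-z) ≤ - -z / Lam := min_le_left _ _
  have h3 : -z / Lam + - -z / Lam = 0 := by ring
  linarith

end Pucci

lemma LocallyLipschitz.exists_lipschitzOnWith_Icc {F : ℝ → ℝ} (hF : LocallyLipschitz F)
    (a b : ℝ) : ∃ K, LipschitzOnWith K F (Icc a b) :=
  hF.locallyLipschitzOn.exists_lipschitzOnWith_of_compact isCompact_Icc

lemma mem_nhds_initialInterval {R : EReal} {r : ℝ} (hr : 0 < r) (hrR : (r : EReal) < R) :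
    {r : ℝ | 0 ≤ r ∧ (r : EReal) < R} ∈ 𝓝 r :=
  inter_mem (Ici_mem_nhds hr)
    (continuous_coe_real_ereal.continuousAt.preimage_mem_nhds (Iio_mem_nhds hrR))

/-- A `C²` solution of `u'' = F u` on `[0, R)`, with the equation read with two-sided derivatives
at `0` too, is a solution of the first order system, provided the acceleration at `0` does not
vanish. -/
lemma solvesNewton_of_deriv_deriv_eq {F u : ℝ → ℝ} {R : EReal} (hR : 0 < R)
    (hu : ContDiffOn ℝ 2 u {r : ℝ | 0 ≤ r ∧ (r : EReal) < R})
    (hF : ∀ r : ℝ, 0 ≤ r → (r : EReal) < R → deriv (deriv u) r = F (u r))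
    (hF0 : F (u 0) ≠ 0) :
    SolvesNewton F u (deriv u) {r : ℝ | 0 ≤ r ∧ (r : EReal) < R} := by
  set S := {r : ℝ | 0 ≤ r ∧ (r : EReal) < R} with hS
  have h0S : (0 : ℝ) ∈ S := ⟨le_rfl, by simpa using hR⟩
  have hat : ∀ r ∈ S, 0 < r → ContDiffAt ℝ 2 u r := fun r hr hr0 =>
    hu.contDiffAt (mem_nhds_initialInterval hr0 hr.2)
  intro r hr
  rcases hr.1.eq_or_lt with rfl | hr0
  · have hdd : DifferentiableAt ℝ (deriv u) 0 :=
      differentiableAt_of_deriv_ne_zero (by rw [hF 0 le_rfl hr.2]; exact hF0)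
    refine ⟨?_, ?_⟩
    · have hsub : S ⊆ Ici 0 := fun s hs => hs.1
      have hpos : Ioi 0 ∩ S ∈ 𝓝[>] (0 : ℝ) := by
        have hlt : ∀ᶠ s : ℝ in 𝓝[>] 0, (s : EReal) < R := mem_nhdsWithin_of_mem_nhds
          (continuous_coe_real_ereal.continuousAt.preimage_mem_nhds (Iio_mem_nhds hr.2))
        filter_upwards [self_mem_nhdsWithin, hlt] with s hs hsR using ⟨hs, le_of_lt hs, hsR⟩
      refine (hasDerivWithinAt_Ici_of_tendsto_deriv (s := Ioi 0 ∩ S) ?_ ?_ hpos ?_).mono hsub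
      · exact fun s hs => ((hat s hs.2 hs.1).differentiableAt
          (by norm_num)).differentiableWithinAt
      · exact (hu.continuousOn 0 h0S).mono inter_subset_right
      · exact hdd.continuousAt.tendsto.mono_left nhdsWithin_le_nhds
    · rw [← hF 0 le_rfl hr.2]
      exact hdd.hasDerivAt.hasDerivWithinAt
  · refine ⟨((hat r hr hr0).differentiableAt (by norm_num)).hasDerivAt.hasDerivWithinAt, ?_⟩
    rw [← hF r hr.1 hr.2]
    have : ContDiffAt ℝ 1 (deriv u) r := (hat r hr hr0).derivWithin (by norm_num)
    exact (this.differentiableAt (by norm_num)).hasDerivAt.hasDerivWithinAt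

namespace SolvesNewton

variable {F x y : ℝ → ℝ} {T : ℝ}

lemma deriv_deriv_eq (h : SolvesNewton F x y (Icc (-T) T)) {t : ℝ} (ht : t ∈ Ioo (-T) T) :
    deriv (deriv x) t = F (x t) := by
  have hx : ∀ s ∈ Ioo (-T) T, deriv x s = y s := fun s hs =>
    ((h s (Ioo_subset_Icc_self hs)).1.hasDerivAt (Icc_mem_nhds hs.1 hs.2)).deriv
  have heq : deriv x =ᶠ[𝓝 t] y := by
    filter_upwards [Ioo_mem_nhds ht.1 ht.2] with s hs using hx s hs
  rw [heq.deriv_eq]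
  exact ((h t (Ioo_subset_Icc_self ht)).2.hasDerivAt (Icc_mem_nhds ht.1 ht.2)).deriv

lemma contDiffOn_two (hF : Continuous F) (h : SolvesNewton F x y (Icc (-T) T)) :
    ContDiffOn ℝ 2 x (Ioo (-T) T) := by
  have h' : ∀ s ∈ Ioo (-T) T, HasDerivAt x (y s) s ∧ HasDerivAt y (F (x s)) s := fun s hs =>
    have hn := Icc_mem_nhds hs.1 hs.2
    ⟨(h s (Ioo_subset_Icc_self hs)).1.hasDerivAt hn, (h s (Ioo_subset_Icc_self hs)).2.hasDerivAt hn⟩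
  have hy : ContDiffOn ℝ 1 y (Ioo (-T) T) := by
    rw [show (1 : WithTop ℕ∞) = 0 + 1 from rfl, contDiffOn_succ_iff_deriv_of_isOpen isOpen_Ioo]
    refine ⟨fun s hs => (h' s hs).2.differentiableAt.differentiableWithinAt, by simp, ?_⟩
    rw [contDiffOn_zero]
    exact (hF.comp_continuousOn (h.continuousOn_fst.mono Ioo_subset_Icc_self)).congr
      fun s hs => (h' s hs).2.deriv
  rw [show (2 : WithTop ℕ∞) = 1 + 1 by norm_num, contDiffOn_succ_iff_deriv_of_isOpen isOpen_Ioo]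
  exact ⟨fun s hs => (h' s hs).1.differentiableAt.differentiableWithinAt, by simp,
    hy.congr fun s hs => (h' s hs).1.deriv⟩

end SolvesNewton

theorem pucci_1d_plus_negative_data
    (lam Lam : ℝ) (hlam : 0 < lam) (hlamLam : lam ≤ Lam)
    (g : ℝ → ℝ) (hg1 : LocallyLipschitz g)
    (hg2 : ∀ t, g (-t) = - g t)
    (α : ℝ) (hα : 0 < α)
    (hg3pos : ∀ t, 0 < t → t < α → 0 < g t)
    (hg3neg : ∀ t, α < t → g t < 0)
    (G : ℝ → ℝ) (hG : ∀ t, G t = ∫ s in (0:ℝ)..t, g s)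
    (ξ : ℝ) (hξα : -α < ξ) (hξ0 : ξ < 0)
    (R : EReal) (hR : 0 < R)
    (u : ℝ → ℝ)
    (hu : ContDiffOn ℝ 2 u {r : ℝ | 0 ≤ r ∧ (r : EReal) < R})
    (hode : ∀ r : ℝ, 0 ≤ r → (r : EReal) < R →
      (if 0 ≤ deriv (deriv u) r then Lam * deriv (deriv u) r
        else lam * deriv (deriv u) r) + g (u r) = 0)
    (hu0 : u 0 = ξ) (hu'0 : deriv u 0 = 0)
    (hmax : ¬ ∃ (R' : EReal) (v : ℝ → ℝ), R < R' ∧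
      ContDiffOn ℝ 2 v {r : ℝ | 0 ≤ r ∧ (r : EReal) < R'} ∧
      (∀ r : ℝ, 0 ≤ r → (r : EReal) < R' →
        (if 0 ≤ deriv (deriv v) r then Lam * deriv (deriv v) r
        else lam * deriv (deriv v) r) + g (v r) = 0) ∧
      v 0 = ξ ∧ deriv v 0 = 0 ∧
      (∀ r : ℝ, 0 ≤ r → (r : EReal) < R → v r = u r))
 :
    R = ⊤ ∧
    (∀ M : ℝ, ∃ r, M ≤ r ∧ u r = 0) ∧
    (∃ T > 0, ∀ r, 0 ≤ r → u (r + T) = u r) ∧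
    sSup ((fun r => |u r|) '' Set.Ici 0) = -ξ := by
  have hLam : 0 < Lam := hlam.trans_le hlamLam
  have hm : 0 < -ξ := by linarith
  set S := {r : ℝ | 0 ≤ r ∧ (r : EReal) < R} with hS
  have h0S : (0 : ℝ) ∈ S := ⟨le_rfl, by simpa using hR⟩
  set F : ℝ → ℝ := pucciAcceleration lam Lam ∘ g with hFdef
  have hFl : LocallyLipschitz F := (locallyLipschitz_pucciAcceleration lam Lam).comp hg1
  set Fc : ℝ → ℝ := F ∘ clampAbs (-ξ) with hFcdef
  obtain ⟨K, hK⟩ := hFl.exists_lipschitzOnWith_Icc (- -ξ) (-ξ)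
  have hFcL : LipschitzWith K Fc := by
    have := hK.comp (lipschitzWith_clampAbs (-ξ)).lipschitzOnWith
      (s := univ) (fun s _ => clampAbs_mem hm.le s)
    simpa [lipschitzOnWith_univ] using this
  have hFceq : ∀ s, |s| ≤ -ξ → F s = Fc s := fun s hs => by
    simp only [hFcdef, Function.comp_apply, clampAbs_of_abs_le hs]
  obtain ⟨B, hB⟩ := isCompact_Icc.exists_bound_of_continuousOn
    (hFl.continuous.continuousOn (s := Icc (- -ξ) (-ξ)))
  have hFcB : ∀ s, |Fc s| ≤ B := fun s => hB _ (clampAbs_mem hm.le s)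
  have hgpos : ∀ s > 0, 0 < g (clampAbs (-ξ) s) := fun s hs =>
    hg3pos _ (clampAbs_pos hm hs) ((clampAbs_mem hm.le s).2.trans_lt (by linarith))
  have hgodd : ∀ s, g (clampAbs (-ξ) (-s)) = -g (clampAbs (-ξ) s) := fun s => by
    rw [clampAbs_neg hm.le, hg2]
  have hpos : ∀ s > 0, Fc s < 0 := fun s hs => pucciAcceleration_neg hlam (hgpos s hs)
  have hneg : ∀ s < 0, 0 < Fc s := fun s hs => by
    refine pucciAcceleration_pos hlam hLam ?_
    have h1 := hgpos (-s) (by linarith)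
    rw [hgodd] at h1
    linarith
  have hsum : ∀ s ≥ 0, Fc s + Fc (-s) ≤ 0 := fun s _ => by
    simp only [hFcdef, hFdef, Function.comp_apply, hgodd]
    exact pucciAcceleration_add_neg_le _ _ _
  have hFξ : 0 < F ξ := by
    rw [hFceq ξ (abs_of_neg hξ0).le]
    exact hneg ξ hξ0
  have hsol : SolvesNewton F u (deriv u) S :=
    solvesNewton_of_deriv_deriv_eq hR hu
      (fun r hr hrR => (pucci_add_eq_zero_iff hlam hlamLam _ _).1 (hode r hr hrR))
      (by rw [hu0]; exact hFξ.ne')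
  have hIcc : ∀ r ∈ S, Icc 0 r ⊆ S := fun r hr s hs =>
    ⟨hs.1, (EReal.coe_le_coe_iff.2 hs.2).trans_lt hr.2⟩
  have hex : ∀ T > 0, ∃ v w : ℝ → ℝ, SolvesNewton Fc v w (Icc (-T) T) ∧ v 0 = ξ ∧ w 0 = 0 ∧
      (∀ t ∈ Icc 0 T, |v t| ≤ -ξ) ∧ ∀ r ∈ S, r ≤ T → u r = v r := by
    intro T hT
    obtain ⟨v, w, hvw, hv0, hw0⟩ := SolvesNewton.exists_Icc hFcL hFcB hT ξ
    have hvw' : SolvesNewton Fc v w (Icc 0 T) := hvw.mono (Icc_subset_Icc_left (by linarith))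
    have hvb := hvw'.abs_le hFcL.continuous hneg hpos hsum hξ0.le hv0 hw0
    refine ⟨v, w, hvw, hv0, hw0, hvb, fun r hr hrT => ?_⟩
    have hur := hsol.mono (hIcc r hr)
    have hsub : Icc 0 r ⊆ Icc 0 T := Icc_subset_Icc_right hrT
    have hvr : SolvesNewton F v w (Icc 0 r) :=
      (hvw'.mono hsub).congr_force fun t ht => (hFceq _ (hvb t (hsub ht))).symm
    obtain ⟨C, hC⟩ := isCompact_Icc.exists_bound_of_continuousOn hur.continuousOn_fst
    obtain ⟨K', hK'⟩ := hFl.exists_lipschitzOnWith_Icc (-max C (-ξ)) (max C (-ξ))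
    exact (hur.eqOn hK' hvr (fun t ht => abs_le.1 ((hC t ht).trans (le_max_left _ _)))
      (fun t ht => abs_le.1 ((hvb t (hsub ht)).trans (le_max_right _ _)))
      (hu0.trans hv0.symm) (hu'0.trans hw0.symm) r ⟨hr.1, le_rfl⟩).1
  have hRtop : R = ⊤ := by
    by_contra hne
    lift R to ℝ using ⟨hne, (EReal.bot_lt_zero.trans hR).ne'⟩
    have hR0 : 0 < R := by simpa using hR
    obtain ⟨v, w, hvw, hv0, hw0, hvb, huv⟩ := hex (R + 2) (by linarith)
    have hmem : ∀ r : ℝ, 0 ≤ r → (r : EReal) < ((R + 1 : ℝ) : EReal) →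
        r ∈ Ioo (-(R + 2)) (R + 2) := fun r hr hrR => by
      have := EReal.coe_lt_coe_iff.1 hrR
      constructor <;> linarith
    refine hmax ⟨((R + 1 : ℝ) : EReal), v, EReal.coe_lt_coe_iff.2 (by linarith),
      (hvw.contDiffOn_two hFcL.continuous).mono fun r hr => hmem r hr.1 hr.2,
      fun r hr hrR => ?_, hv0, ?_, fun r hr hrR => (huv r ⟨hr, hrR⟩ ?_).symm⟩
    · have hr' := hmem r hr hrR
      rw [pucci_add_eq_zero_iff hlam hlamLam, hvw.deriv_deriv_eq hr']
      exact (hFceq _ (hvb r ⟨hr, hr'.2.le⟩)).symm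
    · exact ((hvw 0 ⟨by linarith, by linarith⟩).1.hasDerivAt
        (Icc_mem_nhds (by linarith) (by linarith))).deriv.trans hw0
    · linarith [EReal.coe_lt_coe_iff.1 hrR]
  have hSIci : S = Ici 0 := by
    ext r
    simp [hS, hRtop, EReal.coe_lt_top]
  have hub : ∀ t ≥ 0, |u t| ≤ -ξ := fun t ht => by
    obtain ⟨v, w, -, -, -, hvb, huv⟩ := hex (t + 1) (by linarith)
    rw [huv t (hSIci ▸ ht) (by linarith)]
    exact hvb t ⟨ht, by linarith⟩
  have husol : SolvesNewton Fc u (deriv u) (Ici 0) :=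
    (hSIci ▸ hsol).congr_force fun t ht => hFceq _ (hub t ht)
  obtain ⟨t₁, ht₁, hut₁⟩ := husol.exists_fst_eq_zero hneg (hu0 ▸ hξ0.le) hu'0
  obtain ⟨t₂, ht₂, hut₂⟩ :=
    husol.exists_snd_eq_zero hFcL.continuous hneg hpos hξ0 hu0 hu'0 hub
  have hper := husol.add_two_mul_eq hFcL hu'0 ht₂.le hut₂
  refine ⟨hRtop, fun M => ?_, ⟨2 * t₂, by linarith, hper⟩, ?_⟩
  · have hn : ∀ n : ℕ, u (t₁ + n * (2 * t₂)) = 0 := by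
      intro n
      induction n with
      | zero => simpa using hut₁
      | succ n ih =>
        rw [← ih, ← hper (t₁ + n * (2 * t₂)) (by positivity)]
        push_cast
        ring_nf
    obtain ⟨n, hMn⟩ := exists_nat_ge (M / (2 * t₂))
    rw [div_le_iff₀ (by linarith)] at hMn
    exact ⟨t₁ + n * (2 * t₂), by linarith, hn n⟩
  · refine IsGreatest.csSup_eq ⟨⟨0, self_mem_Ici, ?_⟩, ?_⟩
    · simp only [hu0, abs_of_neg hξ0]
    · rintro _ ⟨r, hr, rfl⟩
      exact hub r hr
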